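/- Let g : ℝ² → ℂ be a Schwartz function with ∫_{ℝ²} g = 0, and define ĝ(ξ) = ∫_{ℝ²} g(y) e^{−i ξ·y} dy. Then the function F(ξ) = ĝ(ξ)/‖ξ‖² · e^{i ξ·x} (set to 0 at ξ = 0) is Lebesgue integrable over ℝ² for every x, and the function u(x) = (1/(2π)²) ∫_{ℝ²} (ĝ(ξ)/‖ξ‖²) e^{i ξ·x} dξ is twice continuously differentiable on ℝ² and satisfies −Δu(x) = g(x) for every x ∈ ℝ²; i.e., u solves the free-space Poisson equation −Δu = g on ℝ². -/

import Mathlib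

open MeasureTheory Real Set
open scoped RealInnerProductSpace Classical

/-- The Fourier transform `ĝ(ξ) = ∫_{ℝ²} g(y) e^{−iξ·y} dy`. -/
noncomputable def fourierHat (g : SchwartzMap (EuclideanSpace ℝ (Fin 2)) ℂ)
    (ξ : EuclideanSpace ℝ (Fin 2)) : ℂ :=
  ∫ y : EuclideanSpace ℝ (Fin 2), g y * Complex.exp (-Complex.I * (⟪ξ, y⟫ : ℝ))

/-- The Fourier-side integrand `F(ξ) = ĝ(ξ)/‖ξ‖² · e^{iξ·x}`, set to `0` at `ξ = 0`. -/
noncomputable def fourierIntegrand (g : SchwartzMap (EuclideanSpace ℝ (Fin 2)) ℂ)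
    (x ξ : EuclideanSpace ℝ (Fin 2)) : ℂ :=
  if ξ = 0 then 0
  else fourierHat g ξ / ((‖ξ‖ ^ 2 : ℝ) : ℂ) * Complex.exp (Complex.I * (⟪ξ, x⟫ : ℝ))

/-- The candidate solution `u(x) = (1/(2π)²) ∫ (ĝ(ξ)/‖ξ‖²) e^{iξ·x} dξ`. -/
noncomputable def poissonSolution (g : SchwartzMap (EuclideanSpace ℝ (Fin 2)) ℂ)
    (x : EuclideanSpace ℝ (Fin 2)) : ℂ :=
  (1 / (2 * π) ^ 2 : ℂ) * ∫ ξ : EuclideanSpace ℝ (Fin 2), fourierIntegrand g x ξ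

/-- The Laplacian `Δu = ∂²u/∂x₁² + ∂²u/∂x₂²` of a complex-valued function on `ℝ²`. -/
noncomputable def laplacian (u : EuclideanSpace ℝ (Fin 2) → ℂ)
    (x : EuclideanSpace ℝ (Fin 2)) : ℂ :=
  ∑ i : Fin 2,
    fderiv ℝ (fun y => fderiv ℝ u y (EuclideanSpace.single i 1)) x (EuclideanSpace.single i 1)

open scoped FourierTransform

lemma fderiv_fourierInv_apply' (f : EuclideanSpace ℝ (Fin 2) → ℂ) (hf : Integrable f)
    (hf1 : Integrable (fun v => ‖v‖ * ‖f v‖)) (x e : EuclideanSpace ℝ (Fin 2)) :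
    fderiv ℝ (𝓕⁻ f) x e = 𝓕⁻ (fun v => (2 * π * Complex.I * ((⟪v, e⟫ : ℝ) : ℂ)) * f v) x := by
  have h1 : 𝓕⁻ f = fun y => 𝓕 f (-y) := by
    ext y; exact fourierInv_eq_fourier_neg f y
  have hint : Integrable (VectorFourier.fourierSMulRight (innerSL ℝ) f) := by
    refine (hf1.const_mul (2 * π * ‖(innerSL ℝ : EuclideanSpace ℝ (Fin 2) →L[ℝ] _)‖)).mono'
      hf.1.fourierSMulRight (Filter.Eventually.of_forall fun v => ?_)
    refine (VectorFourier.norm_fourierSMulRight_le _ _ _).trans (le_of_eq (by ring))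
  have h2 : HasFDerivAt (𝓕⁻ f) (-(𝓕 (VectorFourier.fourierSMulRight (innerSL ℝ) f) (-x))) x := by
    rw [h1]
    have h3 := (Real.hasFDerivAt_fourier hf hf1 (-x)).comp x (hasFDerivAt_id x).neg
    convert! h3 using 1
    ext w
    simp
  rw [h2.fderiv, fourierInv_eq_fourier_neg, neg_apply, fourier_continuousLinearMap_apply hint]
  rw [Real.fourier_eq, Real.fourier_eq, ← integral_neg]
  congr 1
  ext v
  simp [VectorFourier.fourierSMulRight_apply, Circle.smul_def]
  rw [show (innerSL ℝ v) e = ⟪v, e⟫ from rfl]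
  ring

lemma fourierHat_eq (g : SchwartzMap (EuclideanSpace ℝ (Fin 2)) ℂ)
    (η : EuclideanSpace ℝ (Fin 2)) : fourierHat g ((2 * π) • η) = 𝓕 g η := by
  rw [SchwartzMap.fourier_coe, Real.fourier_eq', fourierHat]
  congr 1
  ext v
  rw [inner_smul_left, real_inner_comm, smul_eq_mul, mul_comm]
  congr 2
  simp
  ring

/-- The rescaled multiplier. -/
noncomputable def hfun (g : SchwartzMap (EuclideanSpace ℝ (Fin 2)) ℂ)
    (η : EuclideanSpace ℝ (Fin 2)) : ℂ := 𝓕 g η / (((2 * π) ^ 2 * ‖η‖ ^ 2 : ℝ) : ℂ)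

lemma integrand_eq (g : SchwartzMap (EuclideanSpace ℝ (Fin 2)) ℂ)
    (x η : EuclideanSpace ℝ (Fin 2)) :
    fourierIntegrand g x ((2 * π) • η) =
      Complex.exp ((2 * π * ⟪η, x⟫ : ℝ) * Complex.I) * hfun g η := by
  unfold fourierIntegrand hfun
  by_cases h : η = 0
  · simp [h]
  · have : (2 * π) • η ≠ 0 := smul_ne_zero (by positivity) h
    rw [if_neg this, fourierHat_eq, norm_smul, inner_smul_left, mul_comm]
    congr 2
    · simp
      ring
    · rw [mul_pow, Real.norm_of_nonneg (by positivity)]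

lemma hfun_meas (g : SchwartzMap (EuclideanSpace ℝ (Fin 2)) ℂ) :
    AEStronglyMeasurable (hfun g) := by
  unfold hfun
  have : Measurable (fun η => 𝓕 g η) := (𝓕 g).continuous.measurable
  apply Measurable.aestronglyMeasurable
  fun_prop

lemma hat_zero (g : SchwartzMap (EuclideanSpace ℝ (Fin 2)) ℂ)
    (hg : ∫ y : EuclideanSpace ℝ (Fin 2), g y = 0) : 𝓕 g 0 = 0 := by
  rw [← fourierHat_eq]
  simpa [fourierHat] using hg

lemma hat_bound (G : SchwartzMap (EuclideanSpace ℝ (Fin 2)) ℂ) (h0 : G 0 = 0) :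
    ∃ C, ∀ η, (1 + ‖η‖ ^ 2) * ‖G η‖ ≤ C * ‖η‖ := by
  obtain ⟨C₁, hC₁, h1⟩ := G.decay 0 1
  obtain ⟨C₂, hC₂, h2⟩ := G.decay 1 0
  refine ⟨C₁ + C₂, fun η => ?_⟩
  have h3 : ‖G η‖ ≤ C₁ * ‖η‖ := by
    have := Convex.norm_image_sub_le_of_norm_fderiv_le (𝕜 := ℝ) (f := G) (C := C₁) (s := univ)
      (x := 0) (y := η) (fun x _ => G.differentiableAt) (fun x _ => by
        have := h1 x
        rw [← norm_iteratedFDeriv_one]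
        simpa using this) convex_univ (mem_univ _) (mem_univ _)
    simpa [h0] using this
  have h4 : ‖η‖ * ‖G η‖ ≤ C₂ := by simpa using h2 η
  nlinarith [norm_nonneg η, norm_nonneg (G η), mul_le_mul_of_nonneg_left h4 (norm_nonneg η)]

lemma hfun_norm (g : SchwartzMap (EuclideanSpace ℝ (Fin 2)) ℂ) (η : EuclideanSpace ℝ (Fin 2)) :
    ‖hfun g η‖ = ‖𝓕 g η‖ / ((2 * π) ^ 2 * ‖η‖ ^ 2) := by
  rw [hfun, norm_div, Complex.norm_real, Real.norm_of_nonneg (by positivity)]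

lemma hfun_integrable (g : SchwartzMap (EuclideanSpace ℝ (Fin 2)) ℂ)
    (hg : ∫ y : EuclideanSpace ℝ (Fin 2), g y = 0) : Integrable (hfun g) := by
  obtain ⟨C, hC⟩ := hat_bound (𝓕 g) (hat_zero g hg)
  have hI : Integrable (fun η : EuclideanSpace ℝ (Fin 2) => (‖η‖)⁻¹ * (1 + ‖η‖ ^ 2)⁻¹) := by
    rw [integrable_fun_norm_addHaar volume (f := fun r : ℝ => r⁻¹ * (1 + r ^ 2)⁻¹)]
    refine (integrable_inv_one_add_sq.integrableOn (s := Ioi 0)).congr_fun ?_ measurableSet_Ioi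
    intro y hy
    have : y ≠ 0 := ne_of_gt hy
    simp [this]
  refine (hI.const_mul (C / (2 * π) ^ 2)).mono' (hfun_meas g) (Filter.Eventually.of_forall fun η => ?_)
  rw [hfun_norm]
  rcases eq_or_ne η 0 with rfl | h
  · simp
  have hp : 0 < ‖η‖ := norm_pos_iff.2 h
  have := hC η
  have h5 : C / (2 * π) ^ 2 * (‖η‖⁻¹ * (1 + ‖η‖ ^ 2)⁻¹)
      = (C * ‖η‖) / (1 + ‖η‖ ^ 2) / ((2 * π) ^ 2 * ‖η‖ ^ 2) := by
    field_simp
  rw [h5]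
  gcongr
  rw [le_div_iff₀ (by positivity)]
  linarith

lemma hfun_sq (g : SchwartzMap (EuclideanSpace ℝ (Fin 2)) ℂ)
    (hg : ∫ y : EuclideanSpace ℝ (Fin 2), g y = 0) (η : EuclideanSpace ℝ (Fin 2)) :
    (((2 * π) ^ 2 * ‖η‖ ^ 2 : ℝ) : ℂ) * hfun g η = 𝓕 g η := by
  rcases eq_or_ne η 0 with rfl | h
  · simp [hat_zero g hg]
  have hp : 0 < ‖η‖ := norm_pos_iff.2 h
  have : (((2 * π) ^ 2 * ‖η‖ ^ 2 : ℝ) : ℂ) ≠ 0 := by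
    exact_mod_cast (by positivity : (2 * π) ^ 2 * ‖η‖ ^ 2 ≠ 0)
  rw [hfun, mul_div_cancel₀ _ this]

lemma hfun_integrable2 (g : SchwartzMap (EuclideanSpace ℝ (Fin 2)) ℂ)
    (hg : ∫ y : EuclideanSpace ℝ (Fin 2), g y = 0) :
    Integrable (fun η => ‖η‖ ^ 2 * ‖hfun g η‖) := by
  refine ((𝓕 g).integrable.norm.const_mul (1 / (2 * π) ^ 2)).congr
    (Filter.Eventually.of_forall fun η => ?_)
  simp only
  rw [← hfun_sq g hg, norm_mul, Complex.norm_real, Real.norm_of_nonneg (by positivity)]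
  field_simp

lemma hfun_integrable1 (g : SchwartzMap (EuclideanSpace ℝ (Fin 2)) ℂ)
    (hg : ∫ y : EuclideanSpace ℝ (Fin 2), g y = 0) :
    Integrable (fun η => ‖η‖ * ‖hfun g η‖) := by
  refine ((hfun_integrable g hg).norm.add (hfun_integrable2 g hg)).mono'
    (continuous_norm.aestronglyMeasurable.mul (hfun_meas g).norm)
    (Filter.Eventually.of_forall fun η => ?_)
  rw [Real.norm_of_nonneg (by positivity)]
  simp only [Pi.add_apply]
  nlinarith [norm_nonneg (hfun g η), mul_nonneg (sq_nonneg (‖η‖ - 1)) (norm_nonneg (hfun g η)),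
    mul_nonneg (sq_nonneg (‖η‖)) (norm_nonneg (hfun g η))]

lemma poissonSolution_eq (g : SchwartzMap (EuclideanSpace ℝ (Fin 2)) ℂ) :
    poissonSolution g = 𝓕⁻ (hfun g) := by
  ext x
  rw [Real.fourierInv_eq', poissonSolution]
  have h := Measure.integral_comp_smul volume (fourierIntegrand g x) (2 * π)
  simp only [integrand_eq] at h
  have h2 : ∫ v, Complex.exp ((2 * π * ⟪v, x⟫ : ℝ) * Complex.I) • hfun g v
     = ∫ v, Complex.exp ((2 * π * ⟪v, x⟫ : ℝ) * Complex.I) * hfun g v := rfl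
  rw [h2, h, abs_of_nonneg (by positivity), finrank_euclideanSpace_fin]
  simp

/-- For mean-zero Schwartz data `g` on `ℝ²`, the Fourier-side integrand is integrable, and the
function `u(x) = (1/(2π)²) ∫ (ĝ(ξ)/‖ξ‖²) e^{iξ·x} dξ` is `C²` and solves the free-space
Poisson equation `−Δu = g` on `ℝ²`. -/
theorem poissonSolution_solves_poisson
    (g : SchwartzMap (EuclideanSpace ℝ (Fin 2)) ℂ)
    (hg : ∫ y : EuclideanSpace ℝ (Fin 2), g y = 0) :
    (∀ x : EuclideanSpace ℝ (Fin 2), Integrable (fourierIntegrand g x)) ∧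
      ContDiff ℝ 2 (poissonSolution g) ∧
      ∀ x : EuclideanSpace ℝ (Fin 2), -laplacian (poissonSolution g) x = g x := by
  refine ⟨fun x => ?_, ?_, fun x => ?_⟩
  · rw [← integrable_comp_smul_iff volume (fourierIntegrand g x)
      (by positivity : (2 * π) ≠ 0)]
    simp only [integrand_eq]
    refine (hfun_integrable g hg).bdd_mul (c := 1) ?_ (Filter.Eventually.of_forall fun η => ?_)
    · exact Continuous.aestronglyMeasurable (by fun_prop)
    · rw [Complex.norm_exp_ofReal_mul_I]
  · rw [poissonSolution_eq]
    have h1 : 𝓕⁻ (hfun g) = fun y => 𝓕 (hfun g) (-y) := by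
      ext y; exact fourierInv_eq_fourier_neg _ y
    rw [h1]
    have : ContDiff ℝ 2 (𝓕 (hfun g)) := by
      refine Real.contDiff_fourier (N := 2) fun n hn => ?_
      have hn : n ≤ 2 := by exact_mod_cast hn
      interval_cases n
      · simpa using (hfun_integrable g hg).norm
      · simpa using hfun_integrable1 g hg
      · exact hfun_integrable2 g hg
    exact this.comp contDiff_neg
  · rw [poissonSolution_eq, laplacian]
    have key : ∀ e : EuclideanSpace ℝ (Fin 2), ‖e‖ = 1 →
        Integrable (fun v => (2 * π * Complex.I * ((⟪v, e⟫ : ℝ) : ℂ)) * hfun g v) ∧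
        Integrable (fun v => ‖v‖ * ‖(2 * π * Complex.I * ((⟪v, e⟫ : ℝ) : ℂ)) * hfun g v‖) ∧
        Integrable (fun v => (2 * π * Complex.I * ((⟪v, e⟫ : ℝ) : ℂ)) *
          ((2 * π * Complex.I * ((⟪v, e⟫ : ℝ) : ℂ)) * hfun g v)) := by
      intro e he
      have hm := hfun_meas g
      have hm0 : AEStronglyMeasurable (fun v : EuclideanSpace ℝ (Fin 2) =>
          (2 * π * Complex.I * ((⟪v, e⟫ : ℝ) : ℂ))) :=
        Continuous.aestronglyMeasurable (by fun_prop)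
      have hb : ∀ v : EuclideanSpace ℝ (Fin 2),
          ‖(2 * π * Complex.I * ((⟪v, e⟫ : ℝ) : ℂ))‖ ≤ (2 * π) * ‖v‖ := by
        intro v
        have := norm_inner_le_norm (𝕜 := ℝ) v e
        rw [he, mul_one] at this
        rw [norm_mul, Complex.norm_real]
        have h3 : ‖(2 * π * Complex.I : ℂ)‖ = 2 * π := by
          simp [abs_of_pos pi_pos]
        rw [h3]
        gcongr
      refine ⟨((hfun_integrable1 g hg).const_mul (2 * π)).mono' (hm0.mul hm)
          (Filter.Eventually.of_forall fun v => ?_),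
        ((hfun_integrable2 g hg).const_mul (2 * π)).mono'
          (continuous_norm.aestronglyMeasurable.mul (hm0.mul hm).norm)
          (Filter.Eventually.of_forall fun v => ?_),
        ((hfun_integrable2 g hg).const_mul ((2 * π) * (2 * π))).mono' (hm0.mul (hm0.mul hm))
          (Filter.Eventually.of_forall fun v => ?_)⟩
      · rw [norm_mul, ← mul_assoc]
        gcongr
        exact hb v
      · rw [Real.norm_of_nonneg (by positivity), norm_mul]
        calc _ ≤ ‖v‖ * ((2 * π * ‖v‖) * ‖hfun g v‖) := by gcongr; exact hb v
          _ = _ := by ring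
      · rw [norm_mul, norm_mul _ (hfun g v)]
        calc _ ≤ (2 * π * ‖v‖) * ((2 * π * ‖v‖) * ‖hfun g v‖) :=
              mul_le_mul (hb v) (mul_le_mul_of_nonneg_right (hb v) (norm_nonneg _))
                (by positivity) (by positivity)
          _ = _ := by ring
    have hsum : ∀ i : Fin 2,
        fderiv ℝ (fun y => fderiv ℝ (𝓕⁻ (hfun g)) y (EuclideanSpace.single i 1)) x
          (EuclideanSpace.single i 1) =
        𝓕⁻ (fun v => (2 * π * Complex.I *
            ((⟪v, (EuclideanSpace.single i 1 : EuclideanSpace ℝ (Fin 2))⟫ : ℝ) : ℂ)) *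
          ((2 * π * Complex.I *
            ((⟪v, (EuclideanSpace.single i 1 : EuclideanSpace ℝ (Fin 2))⟫ : ℝ) : ℂ)) *
            hfun g v)) x := by
      intro i
      obtain ⟨k1, k2, k3⟩ := key (EuclideanSpace.single i 1) (by simp)
      rw [← fderiv_fourierInv_apply' _ k1 k2]
      congr 2
      ext y
      exact fderiv_fourierInv_apply' _ (hfun_integrable g hg) (hfun_integrable1 g hg) _ _
    have hinv : 𝓕⁻ (fun η => 𝓕 g η) x = g x := by
      change 𝓕⁻ (⇑(𝓕 g : SchwartzMap (EuclideanSpace ℝ (Fin 2)) ℂ)) x = g x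
      rw [← SchwartzMap.fourierInv_coe, FourierTransform.fourierInv_fourier_eq]
    rw [Finset.sum_congr rfl (fun i _ => hsum i)]
    rw [← hinv, Real.fourierInv_eq, Fin.sum_univ_two, Real.fourierInv_eq, Real.fourierInv_eq,
      ← integral_add, ← integral_neg]
    · congr 1
      ext v
      rw [← hfun_sq g hg v, EuclideanSpace.norm_sq_eq]
      simp [Circle.smul_def, Fin.sum_univ_two, EuclideanSpace.inner_single_right]
      linear_combination (-(4 * π ^ 2 * ((v 0 : ℂ) ^ 2 + (v 1 : ℂ) ^ 2)) * hfun g v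
        * (𝐞 ⟪v, x⟫ : ℂ)) * Complex.I_sq
    · have hc := (Real.fourierIntegral_convergent_iff (-x)).2
        (key (EuclideanSpace.single 0 1) (by simp)).2.2
      simpa only [inner_neg_right, neg_neg] using hc
    · have hc := (Real.fourierIntegral_convergent_iff (-x)).2
        (key (EuclideanSpace.single 1 1) (by simp)).2.2
      simpa only [inner_neg_right, neg_neg] using hc
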